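/- arXiv:2202.02554 — 8 statements merged into one kernel-verified Lean document; each statement's English description precedes it below -/
import Mathlib

section
/- For every integer J ≥ 1, setting N = 2J+2 and K = J+1, there exists an invertible N×N complex matrix Q such that Q⁻¹ · H_N(1) · Q is the block-diagonal matrix ⊕_{j=1}^{K} J^{(2)}(η_j), where η_j = -2·cos(jπ/(K+1)) for j = 1, …, K. In other words, at the exceptional-point value w = 1 the matrix H_N(w) is similar to a direct sum of K Jordan blocks of size 2 with pairwise distinct real eigenvalues η_j. -/
open Matrix Polynomial

/-- For `N = 2J+2`, the `N × N` complex matrix `H_N(w)` (0-based indices `0,…,N-1`):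
`-1` on the sub- and super-diagonal, all diagonal entries zero except the entry
`-i·w` at 0-based position `J` (1-based `J+1`) and `i·w` at 0-based position `J+1`
(1-based `J+2`). -/
noncomputable def Hmat (J : ℕ) (w : ℂ) : Matrix (Fin (2*J+2)) (Fin (2*J+2)) ℂ :=
  Matrix.of fun k l =>
    if (k : ℕ) + 1 = (l : ℕ) ∨ (l : ℕ) + 1 = (k : ℕ) then -1
    else if k = l then
      if (k : ℕ) = J then -Complex.I * w
      else if (k : ℕ) = J + 1 then Complex.I * w
      else 0
    else 0

/-- The value at `x` of the rescaled Chebyshev polynomial `S_{n-1}`, so that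
`chebS x 0 = 0` and `chebS x 1 = 1`. -/
noncomputable def chebS (x : ℂ) (n : ℕ) : ℂ := (Chebyshev.S ℂ ((n : ℤ) - 1)).eval x

/-- The derivative in `x` of `chebS x n`. -/
noncomputable def chebD (x : ℂ) (n : ℕ) : ℂ :=
  (derivative (Chebyshev.S ℂ ((n : ℤ) - 1))).eval x

lemma chebS_zero (x : ℂ) : chebS x 0 = 0 := by simp [chebS]

lemma chebS_one (x : ℂ) : chebS x 1 = 1 := by simp [chebS]

lemma chebD_zero (x : ℂ) : chebD x 0 = 0 := by simp [chebD]

lemma chebS_add_two (x : ℂ) (n : ℕ) :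
    chebS x (n + 2) = x * chebS x (n + 1) - chebS x n := by
  have h := Chebyshev.S_add_two ℂ ((n : ℤ) - 1)
  have e2 : (((n + 2 : ℕ) : ℤ) - 1) = (n : ℤ) - 1 + 2 := by push_cast; ring
  have e1 : (((n + 1 : ℕ) : ℤ) - 1) = (n : ℤ) - 1 + 1 := by push_cast; ring
  simp only [chebS, e1, e2, h, eval_sub, eval_mul, eval_X]

lemma chebD_add_two (x : ℂ) (n : ℕ) :
    chebD x (n + 2) = chebS x (n + 1) + x * chebD x (n + 1) - chebD x n := by
  have h := Chebyshev.S_add_two ℂ ((n : ℤ) - 1)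
  have e2 : (((n + 2 : ℕ) : ℤ) - 1) = (n : ℤ) - 1 + 2 := by push_cast; ring
  have e1 : (((n + 1 : ℕ) : ℤ) - 1) = (n : ℤ) - 1 + 1 := by push_cast; ring
  simp only [chebS, chebD, e1, e2, h, derivative_sub, derivative_mul, derivative_X, eval_sub,
    eval_add, eval_mul, eval_X, one_mul]

lemma chebS_sq_of_succ_eq_zero {x : ℂ} {n : ℕ} (h : chebS x (n + 1) = 0) :
    chebS x n ^ 2 = 1 := by
  have e := congrArg (eval x) (Chebyshev.S_sq_add_S_sq ℂ ((n : ℤ) - 1))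
  have e1 : (((n + 1 : ℕ) : ℤ) - 1) = (n : ℤ) - 1 + 1 := by push_cast; ring
  simp only [eval_sub, eval_add, eval_pow, eval_mul, eval_X, eval_one, ← e1] at e
  change chebS x n ^ 2 + chebS x (n + 1) ^ 2 - x * chebS x n * chebS x (n + 1) = 1 at e
  simpa only [h, ne_eq, OfNat.ofNat_ne_zero, not_false_eq_true, zero_pow, add_zero, mul_zero,
    sub_zero] using e

/-- The eigenvector of `Hmat J 1` for the eigenvalue `-x`, where `chebS x (J + 2) = 0`, indexed
by `1, …, 2J+2` and extended by `0` at `0` and `2J+3`. -/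
noncomputable def eigvec (J : ℕ) (x : ℂ) (k : ℕ) : ℂ :=
  if k ≤ J + 1 then chebS x k else -Complex.I * chebS x (2 * J + 3 - k)

/-- The generalized eigenvector of `Hmat J 1` lying above `eigvec J x`. -/
noncomputable def genvec (J : ℕ) (x : ℂ) (k : ℕ) : ℂ :=
  if k ≤ J + 1 then
    Complex.I * chebD x (J + 2) * chebS x (J + 1) * chebS x k - chebD x k
  else Complex.I * chebD x (2 * J + 3 - k)

/-- The rows of `Hmat J 1`, acting on a sequence that vanishes at both ends. -/
lemma Hmat_mulVec (J : ℕ) (f : ℕ → ℂ) (h0 : f 0 = 0) (hN : f (2 * J + 3) = 0)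
    (k : Fin (2 * J + 2)) :
    (Hmat J 1 *ᵥ fun l => f (l + 1)) k = -f k - f (k + 2) +
      (if (k : ℕ) = J then -Complex.I else if (k : ℕ) = J + 1 then Complex.I else 0) *
        f (k + 1) := by
  obtain ⟨k, hk⟩ := k
  set c : ℂ := if k = J then -Complex.I else if k = J + 1 then Complex.I else 0 with hc
  have hterm : ∀ l : Fin (2 * J + 2), Hmat J 1 ⟨k, hk⟩ l * f (l + 1) =
      (fun l : ℕ => (if l + 1 = k then -f k else 0) + (if k + 1 = l then -f (k + 2) else 0) +
        (if k = l then c * f (k + 1) else 0)) l := by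
    rintro ⟨l, hl⟩
    simp only [Hmat, of_apply, Fin.mk.injEq, mul_one, ← hc]
    rcases lt_trichotomy (l + 1) k with h | h | h
    · simp [show ¬ l + 1 = k by omega, show ¬ k + 1 = l by omega, show ¬ k = l by omega]
    · subst h; simp [show ¬ l + 1 + 1 = l by omega]
    · by_cases h1 : k = l
      · subst h1; simp
      · by_cases h2 : k + 1 = l
        · subst h2; simp [show ¬ k + 1 + 1 = k by omega]
        · simp [h1, h2, show ¬ l + 1 = k by omega]
  simp only [mulVec, dotProduct]
  rw [Finset.sum_congr rfl fun l _ => hterm l, Fin.sum_univ_eq_sum_range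
    (fun l : ℕ => (if l + 1 = k then -f k else 0) + (if k + 1 = l then -f (k + 2) else 0) +
        (if k = l then c * f (k + 1) else 0)), Finset.sum_add_distrib, Finset.sum_add_distrib,
    Finset.sum_ite_eq, Finset.sum_ite_eq, if_pos (Finset.mem_range.2 hk), sub_eq_add_neg]
  congr 2
  · cases k with
    | zero => simp [h0]
    | succ m =>
      simp only [Nat.add_right_cancel_iff]
      rw [Finset.sum_ite_eq', if_pos (Finset.mem_range.2 (by omega))]
  · by_cases h : k + 1 < 2 * J + 2
    · rw [if_pos (Finset.mem_range.2 h)]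
    · rw [if_neg (by simpa using h), show k + 2 = 2 * J + 3 by omega, hN, neg_zero]

lemma Hmat_mulVec_eigvec {J : ℕ} {x : ℂ} (hx : chebS x (J + 2) = 0) (k : Fin (2 * J + 2)) :
    (Hmat J 1 *ᵥ fun l => eigvec J x (l + 1)) k = -x * eigvec J x (k + 1) := by
  rw [Hmat_mulVec J (eigvec J x) (by simp [eigvec, chebS_zero])
    (by simp [eigvec, chebS_zero, show ¬ 2 * J + 3 ≤ J + 1 by omega])]
  obtain ⟨k, hk⟩ := k
  have hI := Complex.I_mul_I
  have hJ := chebS_add_two x J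
  simp only [eigvec]
  rcases lt_trichotomy k J with h | rfl | h
  · simp only [show k ≤ J + 1 by omega, show k + 1 ≤ J + 1 by omega, show k + 2 ≤ J + 1 by omega,
      show ¬ k = J by omega, show ¬ k = J + 1 by omega, if_true, if_false]
    linear_combination -chebS_add_two x k
  · simp only [show k ≤ k + 1 by omega, le_refl, show ¬ k + 2 ≤ k + 1 by omega, if_true, if_false,
      show 2 * k + 3 - (k + 2) = k + 1 by omega]
    linear_combination hx - hJ
  · have hk1 : 2 * J + 3 - (k + 1) = 2 * J + 1 - k + 1 := by omega
    have hk2 : 2 * J + 3 - (k + 2) = 2 * J + 1 - k := by omega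
    rw [if_neg (show ¬ k + 1 ≤ J + 1 by omega), if_neg (show ¬ k + 2 ≤ J + 1 by omega),
      if_neg h.ne', hk1, hk2]
    rcases eq_or_lt_of_le (Nat.succ_le_of_lt h) with rfl | h'
    · simp only [Nat.succ_eq_add_one, le_refl, if_true, show 2 * J + 1 - (J + 1) = J by omega]
      linear_combination Complex.I * (hx - hJ) * (-1) - chebS x (J + 1) * hI
    · rw [if_neg (show ¬ k ≤ J + 1 by omega), if_neg (show ¬ k = J + 1 by omega),
        show 2 * J + 3 - k = 2 * J + 1 - k + 2 by omega]
      linear_combination Complex.I * chebS_add_two x (2 * J + 1 - k)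

lemma Hmat_mulVec_genvec {J : ℕ} {x : ℂ} (hx : chebS x (J + 2) = 0) (k : Fin (2 * J + 2)) :
    (Hmat J 1 *ᵥ fun l => genvec J x (l + 1)) k =
      eigvec J x (k + 1) + -x * genvec J x (k + 1) := by
  rw [Hmat_mulVec J (genvec J x) (by simp [genvec, chebS_zero, chebD_zero])
    (by simp [genvec, chebD_zero, show ¬ 2 * J + 3 ≤ J + 1 by omega])]
  obtain ⟨k, hk⟩ := k
  have hI := Complex.I_mul_I
  have hJ := chebS_add_two x J
  have hD := chebD_add_two x J
  have hsq : chebS x (J + 1) ^ 2 = 1 := chebS_sq_of_succ_eq_zero hx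
  simp only [eigvec, genvec]
  rcases lt_trichotomy k J with h | rfl | h
  · simp only [show k ≤ J + 1 by omega, show k + 1 ≤ J + 1 by omega, show k + 2 ≤ J + 1 by omega,
      show ¬ k = J by omega, show ¬ k = J + 1 by omega, if_true, if_false]
    linear_combination chebD_add_two x k -
      Complex.I * chebD x (J + 2) * chebS x (J + 1) * chebS_add_two x k
  · simp only [show k ≤ k + 1 by omega, le_refl, show ¬ k + 2 ≤ k + 1 by omega, if_true, if_false,
      show 2 * k + 3 - (k + 2) = k + 1 by omega]
    linear_combination hD + Complex.I * chebD x (k + 2) * chebS x (k + 1) * (hx - hJ) -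
      chebD x (k + 2) * chebS x (k + 1) ^ 2 * hI + chebD x (k + 2) * hsq
  · have hk1 : 2 * J + 3 - (k + 1) = 2 * J + 1 - k + 1 := by omega
    have hk2 : 2 * J + 3 - (k + 2) = 2 * J + 1 - k := by omega
    rw [if_neg (show ¬ k + 1 ≤ J + 1 by omega), if_neg (show ¬ k + 1 ≤ J + 1 by omega),
      if_neg (show ¬ k + 2 ≤ J + 1 by omega), if_neg h.ne', hk1, hk2]
    rcases eq_or_lt_of_le (Nat.succ_le_of_lt h) with rfl | h'
    · simp only [Nat.succ_eq_add_one, le_refl, if_true, show 2 * J + 1 - (J + 1) = J by omega]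
      linear_combination chebD x (J + 1) * hI - Complex.I * hD -
        Complex.I * chebD x (J + 2) * hsq
    · rw [if_neg (show ¬ k ≤ J + 1 by omega), if_neg (show ¬ k = J + 1 by omega),
        show 2 * J + 3 - k = 2 * J + 1 - k + 2 by omega]
      linear_combination -Complex.I * chebD_add_two x (2 * J + 1 - k)

/-- The direct sum of the Jordan blocks of size two with eigenvalues `η 0, …, η J`. -/
def jordanTwo (J : ℕ) (η : ℕ → ℂ) : Matrix (Fin (2 * J + 2)) (Fin (2 * J + 2)) ℂ :=
  of fun k l =>
    if k = l then η ((k : ℕ) / 2)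
    else if (k : ℕ) % 2 = 0 ∧ (l : ℕ) = (k : ℕ) + 1 then 1
    else 0

lemma jordanTwo_mulVec_even (J : ℕ) (η : ℕ → ℂ) (z : Fin (2 * J + 2) → ℂ) (j : ℕ)
    (hj : j < J + 1) :
    (jordanTwo J η *ᵥ z) ⟨2 * j, by omega⟩ =
      η j * z ⟨2 * j, by omega⟩ + z ⟨2 * j + 1, by omega⟩ := by
  have h : ∀ l, jordanTwo J η ⟨2 * j, by omega⟩ l * z l =
      (if (⟨2 * j, by omega⟩ : Fin (2 * J + 2)) = l then η j * z l else 0) +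
        (if (⟨2 * j + 1, by omega⟩ : Fin (2 * J + 2)) = l then z l else 0) := by
    rintro ⟨l, hl⟩
    simp only [jordanTwo, of_apply, Fin.mk.injEq]
    by_cases h1 : 2 * j = l
    · subst h1; simp
    · by_cases h2 : 2 * j + 1 = l
      · subst h2; simp
      · simp [h1, h2, Ne.symm h2]
  simp only [mulVec, dotProduct]
  rw [Finset.sum_congr rfl fun l _ => h l, Finset.sum_add_distrib, Finset.sum_ite_eq,
    Finset.sum_ite_eq]
  simp

lemma jordanTwo_mulVec_odd (J : ℕ) (η : ℕ → ℂ) (z : Fin (2 * J + 2) → ℂ) (j : ℕ)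
    (hj : j < J + 1) :
    (jordanTwo J η *ᵥ z) ⟨2 * j + 1, by omega⟩ = η j * z ⟨2 * j + 1, by omega⟩ := by
  have h : ∀ l, jordanTwo J η ⟨2 * j + 1, by omega⟩ l * z l =
      (if (⟨2 * j + 1, by omega⟩ : Fin (2 * J + 2)) = l then η j * z l else 0) := by
    rintro ⟨l, hl⟩
    simp only [jordanTwo, of_apply, Fin.mk.injEq]
    by_cases h1 : 2 * j + 1 = l
    · subst h1; simp [show (2 * j + 1) / 2 = j by omega]
    · simp [h1]
  simp only [mulVec, dotProduct]
  rw [Finset.sum_congr rfl fun l _ => h l, Finset.sum_ite_eq]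
  simp

lemma mul_jordanTwo_even (J : ℕ) (η : ℕ → ℂ) (Q : Matrix (Fin (2 * J + 2)) (Fin (2 * J + 2)) ℂ)
    (k : Fin (2 * J + 2)) (j : ℕ) (hj : j < J + 1) :
    (Q * jordanTwo J η) k ⟨2 * j, by omega⟩ = η j * Q k ⟨2 * j, by omega⟩ := by
  have h : ∀ l, Q k l * jordanTwo J η l ⟨2 * j, by omega⟩ =
      (if (⟨2 * j, by omega⟩ : Fin (2 * J + 2)) = l then η j * Q k l else 0) := by
    rintro ⟨l, hl⟩
    simp only [jordanTwo, of_apply, Fin.mk.injEq]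
    by_cases h1 : 2 * j = l
    · subst h1; simp [mul_comm]
    · simp [h1, Ne.symm h1, show ¬ (l % 2 = 0 ∧ 2 * j = l + 1) by omega]
  rw [mul_apply, Finset.sum_congr rfl fun l _ => h l, Finset.sum_ite_eq]
  simp

lemma mul_jordanTwo_odd (J : ℕ) (η : ℕ → ℂ) (Q : Matrix (Fin (2 * J + 2)) (Fin (2 * J + 2)) ℂ)
    (k : Fin (2 * J + 2)) (j : ℕ) (hj : j < J + 1) :
    (Q * jordanTwo J η) k ⟨2 * j + 1, by omega⟩ =
      Q k ⟨2 * j, by omega⟩ + η j * Q k ⟨2 * j + 1, by omega⟩ := by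
  have h : ∀ l, Q k l * jordanTwo J η l ⟨2 * j + 1, by omega⟩ =
      (if (⟨2 * j, by omega⟩ : Fin (2 * J + 2)) = l then Q k l else 0) +
      (if (⟨2 * j + 1, by omega⟩ : Fin (2 * J + 2)) = l then η j * Q k l else 0) := by
    rintro ⟨l, hl⟩
    simp only [jordanTwo, of_apply, Fin.mk.injEq]
    by_cases h1 : 2 * j = l
    · subst h1; simp
    · by_cases h2 : 2 * j + 1 = l
      · subst h2; simp [mul_comm (η j), show (2 * j + 1) / 2 = j by omega]
      · simp [h1, h2, Ne.symm h2]
  rw [mul_apply, Finset.sum_congr rfl fun l _ => h l, Finset.sum_add_distrib, Finset.sum_ite_eq,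
    Finset.sum_ite_eq]
  simp

lemma forall_fin_of_even_odd {J : ℕ} {P : Fin (2 * J + 2) → Prop}
    (he : ∀ (j : ℕ) (hj : j < J + 1), P ⟨2 * j, by omega⟩)
    (ho : ∀ (j : ℕ) (hj : j < J + 1), P ⟨2 * j + 1, by omega⟩) (k : Fin (2 * J + 2)) : P k := by
  obtain ⟨k, hk⟩ := k
  obtain ⟨j, rfl | rfl⟩ := Nat.even_or_odd' k
  · exact he j (by omega)
  · exact ho j (by omega)

/-- An eigenvector of a direct sum of Jordan blocks with distinct eigenvalues is a multiple of
the first basis vector of one of the blocks. -/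
lemma exists_eq_single_of_jordanTwo_mulVec {J : ℕ} {η : ℕ → ℂ}
    (hη : ∀ i < J + 1, ∀ j < J + 1, η i = η j → i = j) {z : Fin (2 * J + 2) → ℂ} (hz : z ≠ 0)
    {μ : ℂ} (h : jordanTwo J η *ᵥ z = μ • z) :
    ∃ (j : ℕ) (hj : j < J + 1) (c : ℂ), c ≠ 0 ∧ z = Pi.single ⟨2 * j, by omega⟩ c := by
  have he (j : ℕ) (hj : j < J + 1) : (μ - η j) * z ⟨2 * j, by omega⟩ =
      z ⟨2 * j + 1, by omega⟩ := by
    have := congrFun h ⟨2 * j, by omega⟩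
    rw [jordanTwo_mulVec_even J η z j hj, Pi.smul_apply, smul_eq_mul] at this
    linear_combination -this
  have ho (j : ℕ) (hj : j < J + 1) : (μ - η j) * z ⟨2 * j + 1, by omega⟩ = 0 := by
    have := congrFun h ⟨2 * j + 1, by omega⟩
    rw [jordanTwo_mulVec_odd J η z j hj, Pi.smul_apply, smul_eq_mul] at this
    linear_combination -this
  have hodd (j : ℕ) (hj : j < J + 1) : z ⟨2 * j + 1, by omega⟩ = 0 := by
    rcases mul_eq_zero.1 (ho j hj) with h0 | h0
    · rw [← he j hj, h0, zero_mul]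
    · exact h0
  have heven (j : ℕ) (hj : j < J + 1) (hne : z ⟨2 * j, by omega⟩ ≠ 0) : μ = η j := by
    have := he j hj
    rw [hodd j hj] at this
    exact sub_eq_zero.1 ((mul_eq_zero.1 this).resolve_right hne)
  obtain ⟨j, hj, hne⟩ : ∃ (j : ℕ) (hj : j < J + 1), z ⟨2 * j, by omega⟩ ≠ 0 := by
    by_contra! hall
    exact hz (funext (forall_fin_of_even_odd hall hodd))
  refine ⟨j, hj, _, hne, funext (forall_fin_of_even_odd (fun i hi => ?_) fun i hi => ?_)⟩
  · by_cases hij : i = j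
    · subst hij; simp
    · rw [Pi.single_eq_of_ne (by simpa using hij)]
      by_contra h0
      exact hij (hη i hi j hj ((heven i hi h0).symm.trans (heven j hj hne)))
  · rw [hodd i hi, Pi.single_eq_of_ne]
    simp only [ne_eq, Fin.mk.injEq]
    omega

/-- A matrix intertwining some `A` with a direct sum of Jordan blocks of size two with distinct
eigenvalues is invertible as soon as the columns at the start of the blocks do not vanish. -/
lemma isUnit_of_mul_eq_mul_jordanTwo {J : ℕ} {η : ℕ → ℂ}
    (hη : ∀ i < J + 1, ∀ j < J + 1, η i = η j → i = j)
    {A Q : Matrix (Fin (2 * J + 2)) (Fin (2 * J + 2)) ℂ} (hAQ : A * Q = Q * jordanTwo J η)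
    (hQ : ∀ (j : ℕ) (hj : j < J + 1), Q.col ⟨2 * j, by omega⟩ ≠ 0) : IsUnit Q := by
  rw [← mulVec_injective_iff_isUnit, ← Matrix.coe_mulVecLin, ← LinearMap.ker_eq_bot]
  by_contra hker
  have hmap : ∀ z ∈ LinearMap.ker Q.mulVecLin,
      (jordanTwo J η).mulVecLin z ∈ LinearMap.ker Q.mulVecLin := by
    intro z hz
    rw [LinearMap.mem_ker, mulVecLin_apply] at hz ⊢
    rw [mulVecLin_apply, mulVec_mulVec, ← hAQ, ← mulVec_mulVec, hz, mulVec_zero]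
  have : Nontrivial (LinearMap.ker Q.mulVecLin) := Submodule.nontrivial_iff_ne_bot.2 hker
  obtain ⟨μ, hμ⟩ := Module.End.exists_eigenvalue ((jordanTwo J η).mulVecLin.restrict hmap)
  obtain ⟨⟨z, hzQ⟩, hz, hz0⟩ := hμ.exists_hasEigenvector
  rw [Module.End.mem_eigenspace_iff] at hz
  have hz' : jordanTwo J η *ᵥ z = μ • z := congrArg Subtype.val hz
  obtain ⟨j, hj, c, hc, rfl⟩ := exists_eq_single_of_jordanTwo_mulVec hη
    (fun h => hz0 (Subtype.ext h)) hz'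
  rw [LinearMap.mem_ker, mulVecLin_apply, mulVec_single] at hzQ
  refine hQ j hj (funext fun i => ?_)
  have := congrFun hzQ i
  simpa [hc] using this

lemma injective_eigenvalue (J : ℕ) : Function.Injective (fun j : Fin (J + 1) =>
    -2 * Real.cos ((((j : ℕ) + 1 : ℕ) : ℝ) * Real.pi / ((J : ℝ) + 2))) := by
  have hJ : (0 : ℝ) < (J : ℝ) + 2 := by positivity
  have hmem (j : Fin (J + 1)) :
      (((j : ℕ) + 1 : ℕ) : ℝ) * Real.pi / ((J : ℝ) + 2) ∈ Set.Icc 0 Real.pi := by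
    refine ⟨by positivity, ?_⟩
    rw [div_le_iff₀ hJ, mul_comm]
    have : ((j : ℕ) : ℝ) + 1 ≤ (J : ℝ) + 1 := by exact_mod_cast j.isLt
    gcongr
    push_cast
    linarith
  intro i j hij
  have h := Real.injOn_cos (hmem i) (hmem j) (by simpa using hij)
  rw [div_left_inj' hJ.ne', mul_left_inj' Real.pi_ne_zero] at h
  exact Fin.ext (by simpa using h)

lemma chebS_two_mul_cos_eq_zero (J j : ℕ) (hj : j < J + 1) :
    chebS ((2 * Real.cos (((j + 1 : ℕ) : ℝ) * Real.pi / ((J : ℝ) + 2)) : ℝ) : ℂ) (J + 2) = 0 := by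
  have hJ : (0 : ℝ) < (J : ℝ) + 2 := by positivity
  set θ : ℝ := ((j + 1 : ℕ) : ℝ) * Real.pi / ((J : ℝ) + 2) with hθ
  have hsin : Real.sin θ ≠ 0 := by
    refine (Real.sin_pos_of_pos_of_lt_pi (by positivity) ?_).ne'
    rw [hθ, div_lt_iff₀ hJ, mul_comm]
    have : (j : ℝ) + 1 ≤ (J : ℝ) + 1 := by exact_mod_cast hj
    gcongr
    push_cast
    linarith
  have h := Chebyshev.S_two_mul_complex_cos (θ : ℂ) (((J + 2 : ℕ) : ℤ) - 1)
  have harg : (((((J + 2 : ℕ) : ℤ) - 1 : ℤ) : ℂ) + 1) * (θ : ℂ) = ((j + 1 : ℕ) : ℂ) * Real.pi := by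
    have : ((J : ℝ) + 2) * θ = ((j + 1 : ℕ) : ℝ) * Real.pi := by rw [hθ]; field_simp
    have := congrArg (fun r : ℝ => (r : ℂ)) this
    push_cast at this ⊢
    linear_combination this
  rw [harg, Complex.sin_nat_mul_pi] at h
  have hs : Complex.sin (θ : ℂ) ≠ 0 := by exact_mod_cast hsin
  rw [chebS, Complex.ofReal_mul, Complex.ofReal_ofNat, Complex.ofReal_cos]
  exact (mul_eq_zero.1 h).resolve_right hs

/-- At the exceptional-point value `w = 1`, `H_N(1)` (with `N = 2J+2`, `K = J+1`) is
similar to the direct sum `⊕_{j=1}^{K} J^{(2)}(η_j)` of `K` Jordan blocks of size 2,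
with pairwise distinct real eigenvalues `η_j = -2 cos(jπ/(K+1))`, `j = 1,…,K`.
The block-diagonal matrix is written explicitly: its `(k,l)` entry (0-based) is
`η_{k/2+1}` if `k = l`, `1` if `k` is even and `l = k+1`, and `0` otherwise. -/
theorem stmt0 (J : ℕ) (hJ : 1 ≤ J) :
    Function.Injective (fun j : Fin (J+1) =>
      -2 * Real.cos ((((j : ℕ) + 1 : ℕ) : ℝ) * Real.pi / ((J : ℝ) + 2))) ∧
    ∃ Q : Matrix (Fin (2*J+2)) (Fin (2*J+2)) ℂ, IsUnit Q ∧
      Q⁻¹ * Hmat J 1 * Q =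
        Matrix.of (fun k l : Fin (2*J+2) =>
          if k = l then
            ((-2 * Real.cos ((((k : ℕ)/2 + 1 : ℕ) : ℝ) * Real.pi / ((J : ℝ) + 2)) : ℝ) : ℂ)
          else if (k : ℕ) % 2 = 0 ∧ (l : ℕ) = (k : ℕ) + 1 then 1
          else 0) := by
  refine ⟨injective_eigenvalue J, ?_⟩
  set r : ℕ → ℝ := fun j => 2 * Real.cos (((j + 1 : ℕ) : ℝ) * Real.pi / ((J : ℝ) + 2)) with hr
  set η : ℕ → ℂ := fun j => -(r j : ℂ) with hη
  have hinj : ∀ i < J + 1, ∀ j < J + 1, η i = η j → i = j := by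
    intro i hi j hj hij
    have hij' : r i = r j := by simpa [hη] using hij
    have := @injective_eigenvalue J ⟨i, hi⟩ ⟨j, hj⟩ (by simpa [hr] using hij')
    simpa using this
  have hzero (j : ℕ) (hj : j < J + 1) : chebS (r j : ℂ) (J + 2) = 0 :=
    chebS_two_mul_cos_eq_zero J j hj
  let Q : Matrix (Fin (2 * J + 2)) (Fin (2 * J + 2)) ℂ := of fun k l =>
    if (l : ℕ) % 2 = 0 then eigvec J (r ((l : ℕ) / 2)) (k + 1)
    else genvec J (r ((l : ℕ) / 2)) (k + 1)
  have hQe (j : ℕ) (hj : j < J + 1) (k) : Q k ⟨2 * j, by omega⟩ = eigvec J (r j) (k + 1) := by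
    simp [Q]
  have hQo (j : ℕ) (hj : j < J + 1) (k) : Q k ⟨2 * j + 1, by omega⟩ = genvec J (r j) (k + 1) := by
    simp [Q, show (2 * j + 1) / 2 = j by omega]
  have hHQ : Hmat J 1 * Q = Q * jordanTwo J η := by
    ext k l
    revert l
    refine forall_fin_of_even_odd (fun j hj => ?_) fun j hj => ?_
    · rw [mul_jordanTwo_even J η Q k j hj, hQe j hj, ← Hmat_mulVec_eigvec (hzero j hj) k]
      simp only [mul_apply, hQe j hj, mulVec, dotProduct]
    · rw [mul_jordanTwo_odd J η Q k j hj, hQe j hj, hQo j hj,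
        ← Hmat_mulVec_genvec (hzero j hj) k]
      simp only [mul_apply, hQo j hj, mulVec, dotProduct]
  have hQ : IsUnit Q := by
    refine isUnit_of_mul_eq_mul_jordanTwo hinj hHQ fun j hj h => ?_
    have := congrFun h 0
    simp [col_apply, hQe j hj, eigvec, chebS_one] at this
  refine ⟨Q, hQ, ?_⟩
  rw [mul_assoc, hHQ, nonsing_inv_mul_cancel_left _ _ ((isUnit_iff_isUnit_det Q).1 hQ)]
  ext k l
  simp [jordanTwo, hη, hr]
end

section
/- For every integer J ≥ 1, setting N = 2J+2 and K = J+1, and for w = 1 or w = -1, the characteristic polynomial det(X·I − H_N(w)) equals ∏_{j=1}^{K} (X + 2·cos(jπ/(K+1)))². In particular, at the exceptional point every eigenvalue of H_N(±1) is real and has algebraic multiplicity exactly two. -/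
open Matrix Polynomial

/-- The `n × n` tridiagonal matrix with diagonal `d 0, d 1, …` and all entries of the sub- and
superdiagonal equal to `1`. -/
def unitTridiagonal {R : Type*} [CommRing R] (d : ℕ → R) (n : ℕ) : Matrix (Fin n) (Fin n) R :=
  Matrix.of fun k l =>
    if (k : ℕ) + 1 = (l : ℕ) ∨ (l : ℕ) + 1 = (k : ℕ) then 1
    else if k = l then d k
    else 0

theorem det_unitTridiagonal_add_two {R : Type*} [CommRing R] (d : ℕ → R) (n : ℕ) :
    (unitTridiagonal d (n + 2)).det =
      d 0 * (unitTridiagonal (fun k => d (k + 1)) (n + 1)).det -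
        (unitTridiagonal (fun k => d (k + 2)) n).det := by
  have hminor₀ : (unitTridiagonal d (n + 2)).submatrix Fin.succ (Fin.succAbove 0) =
      unitTridiagonal (fun k => d (k + 1)) (n + 1) := by
    ext i j
    simp [unitTridiagonal]
  have hminor₁ : ((unitTridiagonal d (n + 2)).submatrix Fin.succ (Fin.succAbove 1)).det =
      (unitTridiagonal (fun k => d (k + 2)) n).det := by
    rw [det_succ_column_zero, Fin.sum_univ_succ, Finset.sum_eq_zero]
    · have hminor : ((unitTridiagonal d (n + 2)).submatrix Fin.succ (Fin.succAbove 1)).submatrix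
          (Fin.succAbove 0) Fin.succ = unitTridiagonal (fun k => d (k + 2)) n := by
        ext i j
        have : (Fin.succAbove (1 : Fin (n + 2)) j.succ) = j.succ.succ := by
          rw [← Fin.succ_zero_eq_one, Fin.succ_succAbove_succ, Fin.succAbove_zero]
        simp [unitTridiagonal, this]
      rw [hminor]
      simp [unitTridiagonal]
    · intro i _
      simp [unitTridiagonal, Fin.ext_iff]
  rw [det_succ_row_zero, Fin.sum_univ_succ, Fin.sum_univ_succ, Finset.sum_eq_zero, hminor₀,
    Fin.succ_zero_eq_one, hminor₁]
  · simp [unitTridiagonal]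
    ring
  · intro i _
    simp [unitTridiagonal, Fin.ext_iff]

theorem det_unitTridiagonal_of_eq_X {R : Type*} [CommRing R] (d : ℕ → R[X]) (m r : ℕ)
    (hd : ∀ k < m, d k = X) :
    (unitTridiagonal d (m + r + 1)).det =
      Chebyshev.S R m * (unitTridiagonal (fun k => d (k + m)) (r + 1)).det -
        Chebyshev.S R (m - 1) * (unitTridiagonal (fun k => d (k + (m + 1))) r).det := by
  induction m generalizing r with
  | zero =>
    rw [zero_add]
    simp
  | succ m ih =>
    have h := ih (r + 1) fun k hk => hd k (by omega)
    have h₁ : (fun k => d (k + 1 + m)) = fun k => d (k + (m + 1)) := by grind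
    have h₂ : (fun k => d (k + 2 + m)) = fun k => d (k + (m + 1 + 1)) := by grind
    rw [det_unitTridiagonal_add_two, h₁, h₂] at h
    rw [show m + 1 + r + 1 = m + (r + 1) + 1 by ring, h]
    push_cast
    rw [Chebyshev.S_add_one, add_sub_cancel_right, zero_add, hd m (by omega)]
    ring

theorem det_unitTridiagonal_X {R : Type*} [CommRing R] (d : ℕ → R[X]) (n : ℕ)
    (hd : ∀ k < n, d k = X) : (unitTridiagonal d n).det = Chebyshev.S R n := by
  cases n with
  | zero => simp
  | succ n =>
    have h := det_unitTridiagonal_of_eq_X d n 0 fun k hk => hd k (by omega)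
    rw [add_zero] at h
    rw [h]
    push_cast
    rw [Chebyshev.S_add_one]
    simp [unitTridiagonal, hd n (by omega)]
    ring

theorem charpoly_Hmat (J : ℕ) (hJ : 1 ≤ J) (w : ℂ) (hw : w ^ 2 = 1) :
    (Hmat J w).charpoly = Chebyshev.S ℂ (J + 1) ^ 2 := by
  set d : ℕ → ℂ[X] := fun k =>
    if k = J then X + C (Complex.I * w) else if k = J + 1 then X - C (Complex.I * w) else X with hd
  have hmat : (Hmat J w).charmatrix = unitTridiagonal d (2 * J + 2) := by
    ext1 i j
    by_cases hij : i = j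
    · subst hij
      rw [charmatrix_apply_eq]
      simp only [Hmat, unitTridiagonal, hd, Matrix.of_apply]
      split_ifs <;> first | omega | simp
    · rw [charmatrix_apply_ne _ _ _ hij]
      simp only [Hmat, unitTridiagonal, Matrix.of_apply, if_neg hij]
      split_ifs <;> simp
  have hJ₂ : (unitTridiagonal (fun k => d (k + (J + 2))) J).det = Chebyshev.S ℂ J :=
    det_unitTridiagonal_X _ _ fun k _ => by simp only [hd]; grind
  have hJ₁ : (unitTridiagonal (fun k => d (k + (J + 1))) (J + 1)).det =
      (X - C (Complex.I * w)) * Chebyshev.S ℂ J - Chebyshev.S ℂ (J - 1) := by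
    obtain ⟨j, rfl⟩ := Nat.exists_eq_add_of_le' hJ
    rw [det_unitTridiagonal_add_two, det_unitTridiagonal_X _ (j + 1), det_unitTridiagonal_X _ j]
    · simp [hd]
    · intro k _; simp only [hd]; grind
    · intro k _; simp only [hd]; grind
  have hJ₀ : (unitTridiagonal (fun k => d (k + J)) (J + 2)).det =
      (X + C (Complex.I * w)) *
        ((X - C (Complex.I * w)) * Chebyshev.S ℂ J - Chebyshev.S ℂ (J - 1)) -
          Chebyshev.S ℂ J := by
    rw [det_unitTridiagonal_add_two, ← hJ₁, ← hJ₂]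
    simp only [add_assoc, add_comm 1 J, add_comm 2 J]
    simp [hd]
  have hI : (C (Complex.I * w) : ℂ[X]) ^ 2 = -1 := by
    rw [← C_pow, mul_pow, hw, Complex.I_sq]; simp
  rw [charpoly, hmat, show 2 * J + 2 = J + (J + 1) + 1 by ring,
    det_unitTridiagonal_of_eq_X d J (J + 1) fun k hk => by simp only [hd]; grind,
    hJ₀, hJ₁, Chebyshev.S_add_one]
  linear_combination (-Chebyshev.S ℂ J ^ 2) * hI

theorem Polynomial.Chebyshev.monic_S_natCast (R : Type*) [CommRing R] [Nontrivial R] (n : ℕ) :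
    (S R n).Monic ∧ (S R n).natDegree = n := by
  induction n using Nat.twoStepInduction with
  | zero => simp
  | one => simp [monic_X]
  | more n ih₀ ih₁ =>
    push_cast at ih₁ ⊢
    rw [S_add_two]
    have hX : (X * S R (n + 1)).natDegree = n + 2 := by
      rw [monic_X.natDegree_mul ih₁.1, ih₁.2, natDegree_X]; ring
    have hlt : (S R n).natDegree < (X * S R (n + 1)).natDegree := by omega
    exact ⟨(monic_X.mul ih₁.1).sub_of_left (degree_lt_degree hlt),
      (natDegree_sub_eq_left_of_natDegree_lt hlt).trans hX⟩

theorem Polynomial.Chebyshev.S_complex_eq_prod (n : ℕ) :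
    S ℂ n = ∏ j ∈ Finset.range n,
      (X + Polynomial.C ((2 * Real.cos (((j + 1 : ℕ) : ℝ) * Real.pi / (n + 1)) : ℝ) : ℂ)) := by
  set c : ℕ → ℝ := fun j => ((j + 1 : ℕ) : ℝ) * Real.pi / (n + 1) with hc
  have hpos : ∀ j, 0 < c j := fun j => by have := Real.pi_pos; simp only [hc]; positivity
  have hlt : ∀ j < n, c j < Real.pi := fun j hj => by
    have h : ((j + 1 : ℕ) : ℝ) < n + 1 := by exact_mod_cast Nat.succ_lt_succ hj
    simp only [hc]
    rw [div_lt_iff₀ (by positivity)]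
    nlinarith [Real.pi_pos]
  obtain ⟨hmonic, hdeg⟩ := monic_S_natCast ℂ n
  have hfactor : ∀ j ∈ Finset.range n,
      (X + Polynomial.C ((2 * Real.cos (c j) : ℝ) : ℂ)).Monic := fun j _ => monic_X_add_C _
  symm
  refine (eq_of_monic_of_dvd_of_natDegree_le (monic_prod_of_monic _ _ hfactor) hmonic ?_ ?_).symm
  · refine Finset.prod_dvd_of_coprime ?_ ?_
    · intro i hi j hj hij
      have hi' : i < n := by simpa using hi
      have hj' : j < n := by simpa using hj
      have hne : Real.cos (c i) ≠ Real.cos (c j) := fun h => by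
        have := Real.injOn_cos ⟨(hpos i).le, (hlt i hi').le⟩ ⟨(hpos j).le, (hlt j hj').le⟩ h
        simp only [hc] at this
        field_simp at this
        exact hij (by simpa using this)
      have := isCoprime_X_sub_C_of_isUnit_sub (R := ℂ)
        (a := -((2 * Real.cos (c i) : ℝ) : ℂ)) (b := -((2 * Real.cos (c j) : ℝ) : ℂ)) (by
          rw [isUnit_iff_ne_zero, neg_sub_neg, sub_ne_zero]
          exact_mod_cast fun h => hne (by linarith))
      simpa [Function.onFun] using this
    · intro j hj
      have hj' : j < n := by simpa using hj
      rw [← sub_neg_eq_add, ← Polynomial.C_neg, dvd_iff_isRoot, IsRoot]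
      have h := S_two_mul_real_cos (Real.pi - c j) n
      have hsin : Real.sin (((n : ℤ) + 1 : ℝ) * (Real.pi - c j)) = 0 := by
        rw [Real.sin_eq_zero_iff]
        refine ⟨n - j, ?_⟩
        simp only [hc]
        push_cast
        field_simp
        ring
      rw [hsin, Real.sin_pi_sub, Real.cos_pi_sub] at h
      have h₀ := (mul_eq_zero.mp h).resolve_right
        (Real.sin_pos_of_pos_of_lt_pi (hpos j) (hlt j hj')).ne'
      rw [← Complex.ofReal_neg, ← complex_ofReal_eval_S, ← mul_neg, h₀, Complex.ofReal_zero]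
  · rw [hdeg, natDegree_prod_of_monic _ _ hfactor]
    simp only [natDegree_X_add_C]
    simp

/-- For `w = ±1` (exceptional point), the characteristic polynomial of `H_N(w)`
(`N = 2J+2`, `K = J+1`) equals `∏_{j=1}^{K} (X + 2 cos(jπ/(K+1)))²`; in particular
every eigenvalue is real with algebraic multiplicity exactly two. -/
theorem stmt1 (J : ℕ) (hJ : 1 ≤ J) (w : ℂ) (hw : w = 1 ∨ w = -1) :
    (Hmat J w).charpoly =
      ∏ j ∈ Finset.range (J+1),
        (X + C ((2 * Real.cos ((((j : ℕ) + 1 : ℕ) : ℝ) * Real.pi / ((J : ℝ) + 2)) : ℝ) : ℂ)) ^ 2 := by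
  have hw₂ : w ^ 2 = 1 := by rcases hw with rfl | rfl <;> norm_num
  have hS := Chebyshev.S_complex_eq_prod (J + 1)
  push_cast at hS
  rw [charpoly_Hmat J hJ w hw₂, hS, Finset.prod_pow]
  push_cast
  simp only [add_assoc, one_add_one_eq_two]
end

section
/- For every integer J ≥ 1, setting N = 2J+2 and K = J+1, and for each j = 1, …, K, the eigenvalue η_j = -2·cos(jπ/(K+1)) of H_N(1) has geometric multiplicity one; equivalently, the rank of the matrix H_N(1) − η_j·I equals N − 1. -/
open Matrix Polynomial

/-- Row `k` of `(H_N(w) + c·I) v`, for the vector `v k = F (k + 1)` extended by zero boundary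
values at `0` and `N + 1`. -/
theorem Hmat_add_smul_one_mulVec_apply (J : ℕ) (w c : ℂ) (F : ℕ → ℂ) (h0 : F 0 = 0)
    (hN : F (2 * J + 3) = 0) (k : Fin (2 * J + 2)) :
    ((Hmat J w + c • (1 : Matrix (Fin (2 * J + 2)) (Fin (2 * J + 2)) ℂ)) *ᵥ
        fun l => F (l + 1)) k =
      -F k - F (k + 2) +
        ((if (k : ℕ) = J then -Complex.I * w
          else if (k : ℕ) = J + 1 then Complex.I * w else 0) + c) * F (k + 1) := by
  set d : ℂ := if (k : ℕ) = J then -Complex.I * w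
    else if (k : ℕ) = J + 1 then Complex.I * w else 0 with hd
  have hentry : ∀ l : Fin (2 * J + 2),
      (Hmat J w + c • (1 : Matrix (Fin (2 * J + 2)) (Fin (2 * J + 2)) ℂ)) k l * F (l + 1) =
        (if (l : ℕ) = k + 1 then -F (k + 2) else 0) + (if (l : ℕ) + 1 = k then -F k else 0) +
          (if (l : ℕ) = k then (d + c) * F (k + 1) else 0) := by
    intro l
    simp only [Hmat, Matrix.add_apply, Matrix.of_apply, Matrix.smul_apply, Matrix.one_apply,
      Fin.ext_iff, ← hd, smul_eq_mul]
    rcases lt_trichotomy (l : ℕ) k with h | h | h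
    · by_cases h1 : (l : ℕ) + 1 = k
      · simp [← h1, show (l : ℕ) ≠ l + 1 + 1 by omega]
      · simp [h1, h.ne, h.ne', show (k : ℕ) + 1 ≠ l by omega, show (l : ℕ) ≠ k + 1 by omega]
    · simp [h]
    · by_cases h1 : (l : ℕ) = k + 1
      · simp [h1, show (k : ℕ) + 1 + 1 ≠ k by omega]
      · simp [h1, h.ne, h.ne', show (k : ℕ) + 1 ≠ l by omega, show (l : ℕ) + 1 ≠ k by omega]
  have hup : ∑ l : Fin (2 * J + 2), (if (l : ℕ) = k + 1 then -F (k + 2) else 0) =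
      -F (k + 2) := by
    rw [Fin.sum_univ_eq_sum_range (fun l => if l = (k : ℕ) + 1 then -F (k + 2) else 0),
      Finset.sum_ite_eq']
    split_ifs with h
    · rfl
    · rw [Finset.mem_range] at h
      rw [show (k : ℕ) + 2 = 2 * J + 3 by omega, hN, neg_zero]
  have hdown : ∑ l : Fin (2 * J + 2), (if (l : ℕ) + 1 = k then -F k else 0) = -F k := by
    rw [Fin.sum_univ_eq_sum_range (fun l => if l + 1 = (k : ℕ) then -F k else 0)]
    obtain ⟨k, hk⟩ := k
    cases k with
    | zero => simp [h0]
    | succ m =>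
      simp only [Nat.add_right_cancel_iff]
      rw [Finset.sum_ite_eq', if_pos (Finset.mem_range.2 (by omega))]
  have hdiag : ∑ l : Fin (2 * J + 2), (if (l : ℕ) = k then (d + c) * F (k + 1) else 0) =
      (d + c) * F (k + 1) := by
    rw [Fin.sum_univ_eq_sum_range (fun l => if l = (k : ℕ) then (d + c) * F (k + 1) else 0),
      Finset.sum_ite_eq', if_pos (Finset.mem_range.2 k.2)]
  rw [Matrix.mulVec, dotProduct, Finset.sum_congr rfl fun l _ => hentry l,
    Finset.sum_add_distrib, Finset.sum_add_distrib, hup, hdown, hdiag]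
  ring

/-- Since the off-diagonal entries of `H_N(w)` do not vanish, a vector annihilated by
`H_N(w) + c·I` is determined by its first coordinate. -/
theorem eq_zero_of_Hmat_add_smul_one_mulVec_eq_zero {J : ℕ} {w c : ℂ}
    {u : Fin (2 * J + 2) → ℂ}
    (hu : (Hmat J w + c • (1 : Matrix (Fin (2 * J + 2)) (Fin (2 * J + 2)) ℂ)) *ᵥ u = 0)
    (hu0 : u 0 = 0) : u = 0 := by
  let F : ℕ → ℂ := fun m => if h : 1 ≤ m ∧ m ≤ 2 * J + 2 then u ⟨m - 1, by omega⟩ else 0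
  have hF : ∀ l : Fin (2 * J + 2), F (l + 1) = u l := by
    intro l
    have : 1 ≤ (l : ℕ) + 1 ∧ (l : ℕ) + 1 ≤ 2 * J + 2 := by omega
    simp only [F, dif_pos this, Nat.add_sub_cancel]
  have hF0 : F 0 = 0 := by simp [F]
  have hFN : F (2 * J + 3) = 0 := by simp [F]
  have hF1 : F 1 = 0 := by simpa [hu0] using hF 0
  have hrow := Hmat_add_smul_one_mulVec_apply J w c F hF0 hFN
  simp only [hF, hu, Pi.zero_apply] at hrow
  have hzero : ∀ m, m ≤ 2 * J + 2 → F m = 0 ∧ F (m + 1) = 0 := by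
    intro m
    induction m with
    | zero => exact fun _ => ⟨hF0, hF1⟩
    | succ m ih =>
      intro hm
      obtain ⟨h1, h2⟩ := ih (by omega)
      have h := hrow ⟨m, by omega⟩
      rw [← hF ⟨m, by omega⟩] at h
      simp only [h1, h2, mul_zero] at h
      exact ⟨h2, by linear_combination h⟩
  funext l
  rw [← hF l]
  exact (hzero l l.2.le).2

/-- A kernel vector of `H_N(1) + 2 cos θ·I` (with an additional entry on both ends) when
`sin ((J + 2) θ) = 0`. -/
noncomputable def sineMode (J : ℕ) (θ : ℂ) (m : ℕ) : ℂ :=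
  if m ≤ J + 1 then Complex.sin (m * θ)
  else -Complex.I * Complex.sin ((2 * J + 3 - m) * θ)

theorem Complex.sin_sub_add_sin_add (x y : ℂ) :
    Complex.sin (x - y) + Complex.sin (x + y) = 2 * Complex.cos y * Complex.sin x := by
  rw [Complex.sin_sub, Complex.sin_add]
  ring

theorem Hmat_add_smul_one_mulVec_sineMode (J : ℕ) (θ : ℂ)
    (hθ : Complex.sin ((J + 2) * θ) = 0) :
    (Hmat J 1 + (2 * Complex.cos θ) • (1 : Matrix (Fin (2 * J + 2)) (Fin (2 * J + 2)) ℂ)) *ᵥ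
      (fun l => sineMode J θ (l + 1)) = 0 := by
  funext k
  rw [Hmat_add_smul_one_mulVec_apply J 1 _ (sineMode J θ) (by simp [sineMode])
    (by simp [sineMode, show ¬ 2 * J + 2 ≤ J by omega]), Pi.zero_apply]
  have hI := Complex.I_mul_I
  have key := Complex.sin_sub_add_sin_add
  obtain ⟨k, hk⟩ := k
  simp only
  rcases lt_trichotomy k J with h | rfl | h
  · have h3 := key ((k + 1) * θ) θ
    rw [show ((k : ℂ) + 1) * θ - θ = k * θ by ring,
      show ((k : ℂ) + 1) * θ + θ = (k + 2) * θ by ring] at h3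
    simp only [sineMode, if_pos (show k ≤ J + 1 by omega), if_pos (show k + 1 ≤ J + 1 by omega),
      if_pos (show k + 2 ≤ J + 1 by omega), if_neg h.ne, if_neg (show k ≠ J + 1 by omega)]
    push_cast
    linear_combination -h3
  · have h3 := key ((k + 1) * θ) θ
    rw [show ((k : ℂ) + 1) * θ - θ = k * θ by ring,
      show ((k : ℂ) + 1) * θ + θ = (k + 2) * θ by ring] at h3
    simp only [sineMode, if_pos (show k ≤ k + 1 by omega), le_refl,
      if_neg (show ¬ k + 2 ≤ k + 1 by omega), if_true]
    push_cast
    rw [show (2 * (k : ℂ) + 3 - (k + 2)) * θ = (k + 1) * θ by ring]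
    linear_combination -h3 + hθ
  · obtain rfl | h' := (Nat.succ_le_of_lt h).eq_or_lt
    · have h3 := key ((J + 1) * θ) θ
      rw [show ((J : ℂ) + 1) * θ - θ = J * θ by ring,
        show ((J : ℂ) + 1) * θ + θ = (J + 2) * θ by ring] at h3
      simp only [sineMode, Nat.succ_eq_add_one, le_refl, if_true, Nat.succ_ne_self, if_false,
        if_neg (show ¬ J + 1 + 1 ≤ J + 1 by omega), if_neg (show ¬ J + 1 + 2 ≤ J + 1 by omega)]
      push_cast
      rw [show (2 * (J : ℂ) + 3 - (J + 1 + 1)) * θ = (J + 1) * θ by ring,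
        show (2 * (J : ℂ) + 3 - (J + 1 + 2)) * θ = J * θ by ring]
      linear_combination Complex.I * h3 - Complex.I * hθ - Complex.sin ((J + 1) * θ) * hI
    · have h3 := key ((2 * J + 2 - k) * θ) θ
      rw [show (2 * (J : ℂ) + 2 - k) * θ - θ = (2 * J + 1 - k) * θ by ring,
        show (2 * (J : ℂ) + 2 - k) * θ + θ = (2 * J + 3 - k) * θ by ring] at h3
      simp only [sineMode, if_neg (show ¬ k ≤ J + 1 by omega),
        if_neg (show ¬ k + 1 ≤ J + 1 by omega), if_neg (show ¬ k + 2 ≤ J + 1 by omega),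
        if_neg h.ne', if_neg (show k ≠ J + 1 by omega)]
      push_cast
      rw [show (2 * (J : ℂ) + 3 - (k + 1)) * θ = (2 * J + 2 - k) * θ by ring,
        show (2 * (J : ℂ) + 3 - (k + 2)) * θ = (2 * J + 1 - k) * θ by ring]
      linear_combination Complex.I * h3

/-- A nonzero kernel vector of `H_N(w) + c·I` forces the rank to be exactly `N - 1`. -/
theorem rank_Hmat_add_smul_one_of_mulVec_eq_zero {J : ℕ} {w c : ℂ}
    {v : Fin (2 * J + 2) → ℂ} (hv0 : v 0 ≠ 0)
    (hv : (Hmat J w + c • (1 : Matrix (Fin (2 * J + 2)) (Fin (2 * J + 2)) ℂ)) *ᵥ v = 0) :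
    (Hmat J w + c • (1 : Matrix (Fin (2 * J + 2)) (Fin (2 * J + 2)) ℂ)).rank =
      2 * J + 1 := by
  set M := Hmat J w + c • (1 : Matrix (Fin (2 * J + 2)) (Fin (2 * J + 2)) ℂ) with hM
  have hker : Module.finrank ℂ (LinearMap.ker M.mulVecLin) = 1 := by
    refine (finrank_eq_one_iff_of_nonzero' (⟨v, hv⟩ : LinearMap.ker M.mulVecLin) ?_).2 ?_
    · intro h
      exact hv0 (congrFun (congrArg Subtype.val h) 0)
    · rintro ⟨u, hu⟩
      refine ⟨u 0 / v 0, Subtype.ext ?_⟩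
      have hu' : M *ᵥ u = 0 := hu
      refine sub_eq_zero.1
        (eq_zero_of_Hmat_add_smul_one_mulVec_eq_zero (J := J) (w := w) (c := c) ?_ ?_)
      · change M *ᵥ ((u 0 / v 0) • v - u) = 0
        rw [Matrix.mulVec_sub, Matrix.mulVec_smul, hv, hu', smul_zero, sub_zero]
      · simp [div_mul_cancel₀ _ hv0]
  have h := LinearMap.finrank_range_add_finrank_ker M.mulVecLin
  rw [hker, Module.finrank_fin_fun] at h
  rw [Matrix.rank]
  omega

/-- Each eigenvalue `η_j = -2 cos(jπ/(K+1))`, `j = 1,…,K = J+1`, of `H_N(1)` has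
geometric multiplicity one: the rank of `H_N(1) - η_j·I` equals `N - 1 = 2J+1`. -/
theorem stmt2 (J : ℕ) (hJ : 1 ≤ J) (j : ℕ) (hj1 : 1 ≤ j) (hj2 : j ≤ J + 1) :
    (Hmat J 1 -
      ((-2 * Real.cos ((j : ℝ) * Real.pi / ((J : ℝ) + 2)) : ℝ) : ℂ) •
        (1 : Matrix (Fin (2*J+2)) (Fin (2*J+2)) ℂ)).rank = 2*J + 1 := by
  set θ : ℝ := (j : ℝ) * Real.pi / ((J : ℝ) + 2) with hθ
  have hJpos : (0 : ℝ) < (J : ℝ) + 2 := by positivity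
  have hmul : ((J : ℝ) + 2) * θ = j * Real.pi := by
    rw [hθ]
    field_simp
  have hsin : Complex.sin (((J : ℂ) + 2) * (θ : ℂ)) = 0 := by
    have h : ((J : ℂ) + 2) * (θ : ℂ) = (j : ℂ) * (Real.pi : ℂ) := by exact_mod_cast hmul
    rw [h, Complex.sin_nat_mul_pi]
  have hpos : 0 < Real.sin θ := by
    have hj : (0 : ℝ) < j := by exact_mod_cast hj1
    have hjJ : (j : ℝ) < (J : ℝ) + 2 := by exact_mod_cast (show j < J + 2 by omega)
    refine Real.sin_pos_of_pos_of_lt_pi (by have := Real.pi_pos; positivity) ?_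
    rw [hθ, div_lt_iff₀ hJpos, mul_comm]
    exact mul_lt_mul_of_pos_left hjJ Real.pi_pos
  have hmode : sineMode J θ (((0 : Fin (2 * J + 2)) : ℕ) + 1) ≠ 0 := by
    simpa [sineMode] using (show Complex.sin (θ : ℂ) ≠ 0 by exact_mod_cast hpos.ne')
  have hrank := rank_Hmat_add_smul_one_of_mulVec_eq_zero
    (v := fun l => sineMode J θ (l + 1)) hmode (Hmat_add_smul_one_mulVec_sineMode J θ hsin)
  have hcoef : ((-2 * Real.cos θ : ℝ) : ℂ) = -(2 * Complex.cos θ) := by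
    push_cast
    ring
  rw [hcoef, neg_smul, sub_neg_eq_add]
  exact hrank
end

section
/- Let J ≥ 1 be an integer, N = 2J+2, τ ∈ ℝ, α = cos τ, β = sin τ, w = sin 2τ, and x ∈ ℝ. Define ψ ∈ ℂ^N by ψ_k = (α + iβ)·U_{k-1}(x) for 1 ≤ k ≤ J+1 and ψ_k = (α − iβ)·U_{N-k}(x) for J+2 ≤ k ≤ N. Then H_N(w)·ψ = (−2x)·ψ holds if and only if the secular equation U_{J+1}(x) = cos(2τ)·U_J(x) holds. -/
open Matrix Polynomial

/-- Summing over `Fin n` the values of `f` at indices equal to `m`. -/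
lemma sum_fin_ite_coe_eq {n : ℕ} (f : ℤ → ℂ) (m : ℤ) (hm : ¬ (0 ≤ m ∧ m < n) → f m = 0) :
    ∑ l : Fin n, (if (l : ℤ) = m then f l else 0) = f m := by
  by_cases h : 0 ≤ m ∧ m < n
  · obtain ⟨k, rfl⟩ := Int.eq_ofNat_of_zero_le h.1
    have hk : k < n := by omega
    rw [Finset.sum_eq_single (⟨k, hk⟩ : Fin n)]
    · simp
    · intro l _ hl
      rw [if_neg]
      contrapose! hl
      exact Fin.ext (by exact_mod_cast hl)
    · simp
  · rw [hm h]
    refine Finset.sum_eq_zero fun l _ => if_neg ?_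
    have := l.isLt
    omega

/-- The rows of `Hmat J w` applied to a vector extended by zero at positions `-1` and `2J+2`. -/
lemma Hmat_mulVec_apply (J : ℕ) (w : ℂ) (φ : ℤ → ℂ) (h0 : φ (-1) = 0)
    (hN : φ (2 * J + 2) = 0) (k : Fin (2 * J + 2)) :
    (Hmat J w).mulVec (fun l => φ l) k =
      -φ (k - 1) - φ (k + 1) +
        (if (k : ℕ) = J then -Complex.I * w
          else if (k : ℕ) = J + 1 then Complex.I * w else 0) * φ k := by
  have hk := k.isLt
  have h1 := sum_fin_ite_coe_eq (n := 2 * J + 2) φ (k - 1) fun h => by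
    rw [show (k : ℤ) - 1 = -1 by omega, h0]
  have h2 := sum_fin_ite_coe_eq (n := 2 * J + 2) φ (k + 1) fun h => by
    rw [show (k : ℤ) + 1 = 2 * J + 2 by omega, hN]
  have h3 := sum_fin_ite_coe_eq (n := 2 * J + 2) φ k fun h => by omega
  rw [← h1, ← h2, ← h3, Finset.mul_sum, ← Finset.sum_neg_distrib, ← Finset.sum_sub_distrib,
    ← Finset.sum_add_distrib]
  simp only [Matrix.mulVec, dotProduct]
  refine Finset.sum_congr rfl fun l _ => ?_
  simp only [Hmat, Matrix.of_apply, Fin.ext_iff]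
  split_ifs <;> first | omega | ring

lemma chebyshev_U_eval_succ (x : ℝ) (n : ℤ) :
    (Chebyshev.U ℝ (n + 1)).eval x =
      2 * x * (Chebyshev.U ℝ n).eval x - (Chebyshev.U ℝ (n - 1)).eval x := by
  rw [Chebyshev.U_add_one]
  simp

/-- With `α = cos τ`, `β = sin τ`, `w = sin 2τ` and the PT-symmetric ansatz
`ψ_k = (α+iβ)·U_{k-1}(x)` for `1 ≤ k ≤ J+1`, `ψ_k = (α-iβ)·U_{N-k}(x)` for
`J+2 ≤ k ≤ N` (written here with 0-based indices), the eigenvalue equation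
`H_N(w)·ψ = (−2x)·ψ` holds iff the secular equation
`U_{J+1}(x) = cos(2τ)·U_J(x)` holds. -/
theorem stmt3 (J : ℕ) (hJ : 1 ≤ J) (τ x : ℝ) (ψ : Fin (2*J+2) → ℂ)
    (hψ : ∀ k : Fin (2*J+2), ψ k =
      if (k : ℕ) ≤ J then
        ((Real.cos τ : ℂ) + Complex.I * (Real.sin τ : ℂ)) *
          (((Polynomial.Chebyshev.U ℝ ((k : ℕ) : ℤ)).eval x : ℝ) : ℂ)
      else
        ((Real.cos τ : ℂ) - Complex.I * (Real.sin τ : ℂ)) *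
          (((Polynomial.Chebyshev.U ℝ (((2*J+1 - (k : ℕ) : ℕ)) : ℤ)).eval x : ℝ) : ℂ)) :
    (Hmat J ((Real.sin (2*τ) : ℝ) : ℂ)).mulVec ψ = ((-2*x : ℝ) : ℂ) • ψ ↔
      (Polynomial.Chebyshev.U ℝ ((J : ℤ) + 1)).eval x =
        Real.cos (2*τ) * (Polynomial.Chebyshev.U ℝ (J : ℤ)).eval x := by
  set u : ℤ → ℝ := fun n => (Chebyshev.U ℝ n).eval x with hu
  have hrec (n : ℤ) : u (n + 1) = 2 * x * u n - u (n - 1) := chebyshev_U_eval_succ x n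
  have hneg : u (-1) = 0 := by simp [hu]
  set c := Real.cos τ with hc
  set s := Real.sin τ with hs
  have hcs : s ^ 2 + c ^ 2 = 1 := Real.sin_sq_add_cos_sq τ
  have hw : Real.sin (2 * τ) = 2 * s * c := Real.sin_two_mul τ
  have hcos : Real.cos (2 * τ) = 2 * c ^ 2 - 1 := Real.cos_two_mul τ
  set φ : ℤ → ℂ := fun k => if k ≤ J then ((c : ℂ) + Complex.I * s) * (u k : ℂ)
    else ((c : ℂ) - Complex.I * s) * (u (2 * J + 1 - k) : ℂ) with hφ
  have hlo (k : ℤ) (hk : k ≤ J) : φ k = ((c : ℂ) + Complex.I * s) * (u k : ℂ) := if_pos hk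
  have hhi (k m : ℤ) (hk : J < k) (hm : 2 * J + 1 - k = m) :
      φ k = ((c : ℂ) - Complex.I * s) * (u m : ℂ) := by
    subst hm
    exact if_neg (by omega)
  have hψφ : ψ = fun l : Fin (2 * J + 2) => φ l := by
    funext l
    have hl := l.isLt
    rw [hψ]
    split_ifs with h
    · rw [hlo _ (by omega)]
    · rw [hhi _ ((2 * J + 1 - (l : ℕ) : ℕ) : ℤ) (by omega) (by omega)]
  have h0 : φ (-1) = 0 := by rw [hlo _ (by omega), hneg]; simp
  have hN : φ (2 * J + 2) = 0 := by rw [hhi _ (-1) (by omega) (by omega), hneg]; simp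
  change _ ↔ u (J + 1) = Real.cos (2 * τ) * u J
  have hrecC (n : ℤ) : (u (n + 1) : ℂ) = 2 * x * u n - u (n - 1) := by
    exact_mod_cast hrec n
  have hcsC : (s : ℂ) ^ 2 + (c : ℂ) ^ 2 = 1 := by exact_mod_cast hcs
  have hI := Complex.I_sq
  have hJrec := hrecC J
  rw [hψφ, hw, hcos]
  constructor
  · intro h
    have hrow := congrFun h (⟨J, by omega⟩ : Fin (2 * J + 2))
    rw [Hmat_mulVec_apply J _ φ h0 hN] at hrow
    simp only [Pi.smul_apply, smul_eq_mul, if_true] at hrow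
    rw [hlo J le_rfl, hlo (J - 1) (by omega), hhi (J + 1) J (by omega) (by ring)] at hrow
    push_cast at hrow
    have key : (u (J + 1) : ℂ) = (2 * (c : ℂ) ^ 2 - 1) * u J := by
      rw [hJrec]
      linear_combination ((c : ℂ) - Complex.I * s) * hrow -
        (hcsC - (s : ℂ) ^ 2 * hI) *
          (2 * x * u J - u (J - 1) - 2 * Complex.I * s * c * u J + u J)
    exact_mod_cast key
  · intro h
    have hC : (u (J + 1) : ℂ) = (2 * (c : ℂ) ^ 2 - 1) * u J := by exact_mod_cast h
    rw [hJrec] at hC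
    funext k
    have hk := k.isLt
    rw [Hmat_mulVec_apply J _ φ h0 hN]
    simp only [Pi.smul_apply, smul_eq_mul]
    rcases lt_trichotomy (k : ℕ) J with hkJ | hkJ | hkJ
    · rw [if_neg (by omega), if_neg (by omega), hlo _ (by omega), hlo _ (by omega),
        hlo _ (by omega), hrecC]
      push_cast
      ring
    · rw [if_pos hkJ, hkJ, hlo J le_rfl, hlo (J - 1) (by omega),
        hhi (J + 1) J (by omega) (by ring)]
      push_cast
      linear_combination ((c : ℂ) + Complex.I * s) * hC +
        2 * (c : ℂ) * u J * (hcsC - (s : ℂ) ^ 2 * hI)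
    · obtain hk1 | hk1 := Nat.eq_or_lt_of_le (Nat.succ_le_of_lt hkJ)
      · rw [if_neg (by omega), if_pos hk1.symm, ← hk1, hlo _ (by push_cast; omega),
          hhi _ (J - 1) (by push_cast; omega) (by push_cast; ring),
          hhi _ J (by push_cast; omega) (by push_cast; ring)]
        push_cast
        simp only [add_sub_cancel_right]
        linear_combination ((c : ℂ) - Complex.I * s) * hC +
          2 * (c : ℂ) * u J * (hcsC - (s : ℂ) ^ 2 * hI)
      · have hr := hrecC (2 * J + 1 - k)
        rw [if_neg (by omega), if_neg (by omega), hhi _ (2 * J + 1 - k + 1) (by omega) (by ring),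
          hhi _ (2 * J + 1 - k - 1) (by omega) (by ring), hhi _ (2 * J + 1 - k) (by omega) rfl, hr]
        push_cast
        ring
end

section
/- For every integer J ≥ 1, N = 2J+2, and every real number w with |w| < 1, the matrix H_N(w) has N pairwise distinct real eigenvalues; that is, its characteristic polynomial has N distinct real roots. Hence the unitarity-compatible interval w ∈ (−1,1) of parameters is the same for all of the bound states at arbitrary even matrix dimension N. -/
open Matrix Polynomial

/-- A vector annihilated by an unreduced lower Hessenberg system vanishes once its first
coordinate does. -/
theorem eq_zero_of_mulVec_eq_smul_of_hessenberg {K : Type*} [Field K] {n : ℕ}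
    {A : Matrix (Fin (n + 1)) (Fin (n + 1)) K}
    (hsup : ∀ k l : Fin (n + 1), (k : ℕ) + 1 = l → A k l ≠ 0)
    (hzero : ∀ k l : Fin (n + 1), (k : ℕ) + 1 < l → A k l = 0)
    {v : Fin (n + 1) → K} {r : K} (hv : A *ᵥ v = r • v) (h0 : v 0 = 0) : v = 0 := by
  have key : ∀ m (hm : m < n + 1), v ⟨m, hm⟩ = 0 := by
    intro m
    induction m using Nat.strong_induction_on with
    | _ m ih =>
      intro hm
      rcases m with _ | m
      · exact h0
      have hrow := congrFun hv ⟨m, by omega⟩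
      rw [Pi.smul_apply, ih m (by omega), smul_zero, Matrix.mulVec, dotProduct,
        Finset.sum_eq_single ⟨m + 1, hm⟩] at hrow
      · exact (mul_eq_zero.mp hrow).resolve_left (hsup _ _ rfl)
      · intro l _ hl
        rcases lt_or_ge (l : ℕ) (m + 1) with h | h
        · rw [ih l h, mul_zero]
        · rw [hzero _ _ (lt_of_le_of_ne h fun h' => hl (Fin.ext h'.symm)), zero_mul]
      · simp
  exact funext fun k => key k k.2

/-- A Hermitian matrix with nonvanishing superdiagonal and zeros above it has simple spectrum. -/
theorem Matrix.IsHermitian.eigenvalues_injective_of_hessenberg {𝕜 : Type*} [RCLike 𝕜] {n : ℕ}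
    {A : Matrix (Fin (n + 1)) (Fin (n + 1)) 𝕜} (hA : A.IsHermitian)
    (hsup : ∀ k l : Fin (n + 1), (k : ℕ) + 1 = l → A k l ≠ 0)
    (hzero : ∀ k l : Fin (n + 1), (k : ℕ) + 1 < l → A k l = 0) :
    Function.Injective hA.eigenvalues := by
  intro i j hij
  by_contra hne
  have eigen (k) : A *ᵥ ⇑(hA.eigenvectorBasis k) =
      (hA.eigenvalues k : 𝕜) • ⇑(hA.eigenvectorBasis k) := by
    rw [hA.mulVec_eigenvectorBasis, RCLike.real_smul_eq_coe_smul (K := 𝕜)]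
  set a := hA.eigenvectorBasis i 0
  set b := hA.eigenvectorBasis j 0
  have hcomb : b • hA.eigenvectorBasis i + (-a) • hA.eigenvectorBasis j = 0 := by
    refine (WithLp.ofLp_injective 2) ?_
    refine eq_zero_of_mulVec_eq_smul_of_hessenberg hsup hzero
      (r := (hA.eigenvalues i : 𝕜)) ?_ ?_
    · simp only [WithLp.ofLp_add, WithLp.ofLp_smul, Matrix.mulVec_add, Matrix.mulVec_smul, eigen,
        ← hij, smul_add]
      rw [smul_comm b, smul_comm (-a)]
    · simp [a, b, mul_comm]
  have hb : b = 0 := by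
    have h := congrArg (fun x => inner 𝕜 (hA.eigenvectorBasis i) x) hcomb
    simpa [inner_add_right, inner_smul_right, hA.eigenvectorBasis.inner_eq_ite, hne] using h
  exact hA.eigenvectorBasis.orthonormal.ne_zero j <| WithLp.ofLp_injective 2 <|
    eq_zero_of_mulVec_eq_smul_of_hessenberg hsup hzero (eigen j) hb

/-- Coupling two copies of `T` through `E` by `!![-a, -1; -1, a]` or by `!![0, -c; -c, 0]` gives
the same characteristic polynomial when `c ^ 2 = 1 + a ^ 2`. -/
theorem Matrix.charpoly_fromBlocks_coupling {K m : Type*} [Field K] [Fintype m] [DecidableEq m]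
    (T E : Matrix m m K) {a c : K} (hc : c ≠ 0) (hac : c ^ 2 = 1 + a ^ 2) :
    (fromBlocks (T - a • E) (-E) (-E) (T + a • E)).charpoly =
      (fromBlocks T (-(c • E)) (-(c • E)) T).charpoly := by
  set S : Matrix (m ⊕ m) (m ⊕ m) K := fromBlocks (c • 1) (a • 1) 0 1
  set S' : Matrix (m ⊕ m) (m ⊕ m) K := fromBlocks (c⁻¹ • 1) (-(c⁻¹ * a) • 1) 0 1
  have hS : S * S' = 1 := by
    simp [S, S', fromBlocks_multiply, smul_smul, hc, ← fromBlocks_one, mul_right_comm c⁻¹ a c]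
  have hcomm : fromBlocks (T - a • E) (-E) (-E) (T + a • E) * S =
      S * fromBlocks T (-(c • E)) (-(c • E)) T := by
    have hE : c • c • E = E + a • a • E := by
      rw [smul_smul, smul_smul, ← sq, ← sq, hac, add_smul, one_smul]
    simp only [S, fromBlocks_multiply, Matrix.mul_smul, Matrix.smul_mul, Matrix.mul_one,
      Matrix.one_mul, Matrix.mul_zero, Matrix.zero_mul, smul_neg, smul_sub, hE]
    congr 1
    · rw [smul_comm]; abel
    · abel
    · simp
    · simp
  calc _ = (fromBlocks (T - a • E) (-E) (-E) (T + a • E) * S * S').charpoly := by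
        rw [Matrix.mul_assoc, hS, Matrix.mul_one]
    _ = _ := by
        rw [hcomm, charpoly_mul_comm, ← Matrix.mul_assoc, mul_eq_one_comm.mp hS, Matrix.one_mul]

/-- The path matrix on `2J+2` vertices with weights `-1`, except for the weight `-c` of the
central edge. -/
noncomputable def weakLinkPath (J : ℕ) (c : ℝ) : Matrix (Fin (2*J+2)) (Fin (2*J+2)) ℂ :=
  Matrix.of fun k l =>
    if (k : ℕ) + 1 = (l : ℕ) ∨ (l : ℕ) + 1 = (k : ℕ) then
      if (k : ℕ) + l = 2 * J + 1 then -c else -1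
    else 0

theorem weakLinkPath_isHermitian (J : ℕ) (c : ℝ) : (weakLinkPath J c).IsHermitian := by
  refine Matrix.IsHermitian.ext fun k l => ?_
  simp only [weakLinkPath, Matrix.of_apply, or_comm, add_comm]
  split_ifs <;> simp

/-- The splitting of `Fin (2*J+2)` into two halves, the second one listed in reverse order. -/
def foldEquiv (J : ℕ) : Fin (J + 1) ⊕ Fin (J + 1) ≃ Fin (2*J+2) :=
  ((Equiv.sumCongr (Equiv.refl _) Fin.revPerm).trans finSumFinEquiv).trans
    (finCongr (by omega))

@[simp]
theorem foldEquiv_inl (J : ℕ) (k : Fin (J + 1)) : (foldEquiv J (Sum.inl k) : ℕ) = k := by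
  simp [foldEquiv]

@[simp]
theorem foldEquiv_inr (J : ℕ) (k : Fin (J + 1)) :
    (foldEquiv J (Sum.inr k) : ℕ) = 2 * J + 1 - k := by
  simp [foldEquiv]
  omega

theorem Hmat_charpoly_eq_weakLinkPath_charpoly (J : ℕ) {w c : ℝ} (hc : c ≠ 0)
    (hwc : c ^ 2 = 1 - w ^ 2) : (Hmat J (w : ℂ)).charpoly = (weakLinkPath J c).charpoly := by
  set T : Matrix (Fin (J + 1)) (Fin (J + 1)) ℂ := Matrix.of fun k l =>
    if (k : ℕ) + 1 = (l : ℕ) ∨ (l : ℕ) + 1 = (k : ℕ) then -1 else 0 with hT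
  set E : Matrix (Fin (J + 1)) (Fin (J + 1)) ℂ := Matrix.of fun k l =>
    if (k : ℕ) = J ∧ (l : ℕ) = J then 1 else 0 with hE
  have hH : reindex (foldEquiv J).symm (foldEquiv J).symm (Hmat J (w : ℂ)) =
      fromBlocks (T - (Complex.I * w) • E) (-E) (-E) (T + (Complex.I * w) • E) := by
    ext (k | k) (l | l) <;>
    · have hk := k.2
      have hl := l.2
      simp only [reindex_apply, Equiv.symm_symm, submatrix_apply, Hmat, of_apply, Fin.ext_iff,
        foldEquiv_inl, foldEquiv_inr, fromBlocks_apply₁₁, fromBlocks_apply₁₂, fromBlocks_apply₂₁,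
        fromBlocks_apply₂₂, hT, hE, Matrix.sub_apply, Matrix.add_apply, Matrix.neg_apply,
        Matrix.smul_apply, smul_eq_mul]
      split_ifs <;> first | omega | simp
  have hK : reindex (foldEquiv J).symm (foldEquiv J).symm (weakLinkPath J c) =
      fromBlocks T (-((c : ℂ) • E)) (-((c : ℂ) • E)) T := by
    ext (k | k) (l | l) <;>
    · have hk := k.2
      have hl := l.2
      simp only [reindex_apply, Equiv.symm_symm, submatrix_apply, weakLinkPath, of_apply,
        foldEquiv_inl, foldEquiv_inr, fromBlocks_apply₁₁, fromBlocks_apply₁₂, fromBlocks_apply₂₁,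
        fromBlocks_apply₂₂, hT, hE, Matrix.neg_apply, Matrix.smul_apply, smul_eq_mul]
      split_ifs <;> first | omega | simp
  rw [← charpoly_reindex (foldEquiv J).symm (Hmat J (w : ℂ)), hH,
    ← charpoly_reindex (foldEquiv J).symm (weakLinkPath J c), hK]
  refine charpoly_fromBlocks_coupling T E (by exact_mod_cast hc) ?_
  rw [mul_pow, Complex.I_sq]
  exact_mod_cast (by linarith : c ^ 2 = 1 + -1 * w ^ 2)

/-- For every real `w` with `|w| < 1`, the matrix `H_N(w)` (`N = 2J+2`) has `N`
pairwise distinct real eigenvalues: its characteristic polynomial splits into `N`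
distinct real linear factors. -/
theorem stmt6 (J : ℕ) (hJ : 1 ≤ J) (w : ℝ) (hw : |w| < 1) :
    ∃ r : Fin (2*J+2) → ℝ, Function.Injective r ∧
      (Hmat J (w : ℂ)).charpoly = ∏ j : Fin (2*J+2), (X - C ((r j : ℝ) : ℂ)) := by
  have hw2 : 0 < 1 - w ^ 2 := by
    rw [sub_pos, sq_lt_one_iff_abs_lt_one]
    exact hw
  have hc : √(1 - w ^ 2) ≠ 0 := (Real.sqrt_pos.mpr hw2).ne'
  have hherm := weakLinkPath_isHermitian J √(1 - w ^ 2)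
  refine ⟨hherm.eigenvalues, hherm.eigenvalues_injective_of_hessenberg ?_ ?_, ?_⟩
  · intro k l hkl
    simp only [weakLinkPath, of_apply, hkl, true_or, if_true]
    split_ifs
    · exact neg_ne_zero.mpr (Complex.ofReal_ne_zero.mpr hc)
    · simp
  · intro k l hkl
    rw [weakLinkPath, of_apply, if_neg (by omega)]
  · rw [Hmat_charpoly_eq_weakLinkPath_charpoly J hc (Real.sq_sqrt hw2.le)]
    exact hherm.charpoly_eq
end

section
/- For every integer K ≥ 2, N = 2K, and all complex numbers ρ and w, the characteristic polynomial det(X·I − H_N(ρ,w)) contains only even powers of X; equivalently, the spectrum of H_N(ρ,w) is symmetric under the reflection F ↦ −F. -/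
open Matrix Polynomial

/-- For `N = 2K`, the `N × N` complex matrix `H_N(ρ,w)` (0-based indices `0,…,N-1`):
`-1` on the sub- and super-diagonal, diagonal entries `-i·ρ` at position `0`
(1-based `1`), `-i·w` at position `K-1` (1-based `K`), `i·w` at position `K`
(1-based `K+1`), `i·ρ` at position `N-1` (1-based `N`), all other entries zero. -/
noncomputable def HmatRW (K : ℕ) (ρ w : ℂ) : Matrix (Fin (2*K)) (Fin (2*K)) ℂ :=
  Matrix.of fun k l =>
    if (k : ℕ) + 1 = (l : ℕ) ∨ (l : ℕ) + 1 = (k : ℕ) then -1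
    else if k = l then
      if (k : ℕ) = 0 then -Complex.I * ρ
      else if (k : ℕ) + 1 = K then -Complex.I * w
      else if (k : ℕ) = K then Complex.I * w
      else if (k : ℕ) + 1 = 2*K then Complex.I * ρ
      else 0
    else 0

/-- The characteristic polynomial of a matrix of even size and that of its negative are related
by the substitution `X ↦ -X`. -/
theorem Matrix.charpoly_neg_of_even_card {R n : Type*} [CommRing R] [IsDomain R] [Infinite R]
    [Fintype n] [DecidableEq n] (hn : Even (Fintype.card n)) (M : Matrix n n R) :
    (-M).charpoly = M.charpoly.comp (-X) := by
  refine Polynomial.funext fun t => ?_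
  have h : Matrix.scalar n (-t) - M = -(Matrix.scalar n t - -M) := by
    rw [map_neg]; abel
  rw [eval_comp, eval_neg, eval_X, eval_charpoly, eval_charpoly, h, det_neg, hn.neg_one_pow,
    one_mul]

/-- If the characteristic polynomial of a matrix of even size agrees with that of its negative,
then its odd coefficients vanish. -/
theorem Matrix.charpoly_coeff_eq_zero_of_odd {R n : Type*} [CommRing R] [IsDomain R] [CharZero R]
    [Fintype n] [DecidableEq n] (hn : Even (Fintype.card n)) {M : Matrix n n R}
    (hM : (-M).charpoly = M.charpoly) {k : ℕ} (hk : Odd k) : M.charpoly.coeff k = 0 := by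
  have h := congrArg (fun p => p.coeff k) ((charpoly_neg_of_even_card hn M).symm.trans hM)
  have hc : (M.charpoly.comp (-X)).coeff k = -M.charpoly.coeff k := by
    rw [show (-X : R[X]) = C (-1) * X by simp, comp_C_mul_X_coeff, hk.neg_one_pow, mul_neg_one]
  simp only [hc] at h
  exact self_eq_neg.mp h.symm

/-- Reversing the order of the sites and alternating signs turns `H_N(ρ,w)` into its negative. -/
theorem HmatRW_submatrix_rev (K : ℕ) (hK : 2 ≤ K) (ρ w : ℂ) :
    (HmatRW K ρ w).submatrix Fin.rev Fin.rev =
      diagonal (fun i : Fin (2 * K) => (-1 : ℂ) ^ (i : ℕ)) * -HmatRW K ρ w *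
        diagonal (fun i : Fin (2 * K) => (-1 : ℂ) ^ (i : ℕ)) := by
  ext ⟨k, hk⟩ ⟨l, hl⟩
  have hsq : (-1 : ℂ) ^ k * (-1 : ℂ) ^ k = 1 := by
    rw [← mul_pow]; simp
  simp only [mul_diagonal, diagonal_mul, submatrix_apply, HmatRW, Matrix.neg_apply, of_apply,
    Fin.val_rev, Fin.rev_inj, Fin.mk.injEq]
  by_cases hadj : k + 1 = l ∨ l + 1 = k
  · rw [if_pos (by omega), if_pos hadj]
    rcases hadj with rfl | rfl
    · rw [pow_succ]; linear_combination hsq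
    · rw [pow_succ] at hsq ⊢; linear_combination hsq
  rw [if_neg (by omega), if_neg hadj]
  by_cases hkl : k = l
  · subst hkl
    rw [if_pos rfl, if_pos rfl, mul_right_comm, hsq, one_mul]
    split_ifs <;> first | omega | ring
  · simp [hkl]

theorem charpoly_neg_HmatRW (K : ℕ) (hK : 2 ≤ K) (ρ w : ℂ) :
    (-HmatRW K ρ w).charpoly = (HmatRW K ρ w).charpoly := by
  have hD : diagonal (fun i : Fin (2 * K) => (-1 : ℂ) ^ (i : ℕ)) *
      diagonal (fun i : Fin (2 * K) => (-1 : ℂ) ^ (i : ℕ)) = 1 := by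
    rw [diagonal_mul_diagonal, ← diagonal_one]
    congr 1
    funext i
    rw [← mul_pow]; simp
  have h := charpoly_reindex Fin.revPerm (HmatRW K ρ w)
  rw [reindex_apply] at h
  change ((HmatRW K ρ w).submatrix Fin.rev Fin.rev).charpoly = _ at h
  rw [HmatRW_submatrix_rev K hK, charpoly_mul_comm, ← mul_assoc, hD, one_mul] at h
  exact h

/-- For all complex `ρ` and `w`, the characteristic polynomial of `H_N(ρ,w)` (`N = 2K`)
contains only even powers of `X`: every coefficient of an odd power vanishes. -/
theorem stmt10 (K : ℕ) (hK : 2 ≤ K) (ρ w : ℂ) :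
    ∀ n : ℕ, Odd n → (HmatRW K ρ w).charpoly.coeff n = 0 := by
  intro n hn
  exact charpoly_coeff_eq_zero_of_odd (by simp) (charpoly_neg_HmatRW K hK ρ w) hn
end

section
/- For every w ∈ ℂ, the characteristic polynomial of the 10×10 matrix H_10(w) (the case J = 4 of the model) equals X^10 + (w² − 9)·X^8 + (28 − 6w²)·X^6 + (11w² − 35)·X^4 + (15 − 6w²)·X² + (w² − 1). In particular, the secular polynomial is a linear function of w². -/
open Matrix Polynomial

/-- The `10 × 10` complex matrix `H_10(w)` (0-based indices `0,…,9`): `-1` on the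
sub- and super-diagonal, diagonal entries zero except `-i·w` at position `4`
(1-based `5`) and `i·w` at position `5` (1-based `6`). -/
noncomputable def H10 (w : ℂ) : Matrix (Fin 10) (Fin 10) ℂ :=
  Matrix.of fun k l =>
    if (k : ℕ) + 1 = (l : ℕ) ∨ (l : ℕ) + 1 = (k : ℕ) then -1
    else if k = l then
      if (k : ℕ) = 4 then -Complex.I * w
      else if (k : ℕ) = 5 then Complex.I * w
      else 0
    else 0

/-- The tridiagonal determinant of order ten whose diagonal is constant except for its two middle
entries. -/
theorem det_unitTridiagonal_ten {R : Type*} [CommRing R] (x a b : R) :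
    (unitTridiagonal (fun k => if k = 4 then a else if k = 5 then b else x) 10).det =
      (a * (x ^ 4 - 3 * x ^ 2 + 1) - (x ^ 3 - 2 * x)) *
        (b * (x ^ 4 - 3 * x ^ 2 + 1) - (x ^ 3 - 2 * x)) - (x ^ 4 - 3 * x ^ 2 + 1) ^ 2 := by
  have hone (d : ℕ → R) : (unitTridiagonal d 1).det = d 0 := by
    simp [unitTridiagonal]
  simp only [det_unitTridiagonal_add_two, hone, det_fin_zero]
  norm_num
  ring

/-- The characteristic polynomial of `H_10(w)` equals
`X^10 + (w²−9)X^8 + (28−6w²)X^6 + (11w²−35)X^4 + (15−6w²)X² + (w²−1)`;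
in particular it is a linear function of `w²`. -/
theorem stmt11 (w : ℂ) :
    (H10 w).charpoly =
      X^10 + C (w^2 - 9) * X^8 + C (28 - 6*w^2) * X^6 + C (11*w^2 - 35) * X^4
        + C (15 - 6*w^2) * X^2 + C (w^2 - 1) := by
  have hmat : (H10 w).charmatrix = unitTridiagonal
      (fun k => if k = 4 then X + C (Complex.I * w) else if k = 5 then X - C (Complex.I * w)
        else X) 10 := by
    ext1 k l
    by_cases hkl : k = l
    · subst hkl
      simp only [charmatrix_apply_eq, H10, unitTridiagonal, of_apply]
      split_ifs <;> first | omega | simp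
    · simp only [charmatrix_apply_ne _ _ _ hkl, H10, unitTridiagonal, of_apply, if_neg hkl]
      split_ifs <;> simp
  have hsq : C Complex.I ^ 2 = (-1 : ℂ[X]) := by
    rw [← C_pow, Complex.I_sq, C_neg, C_1]
  rw [Matrix.charpoly, hmat, det_unitTridiagonal_ten]
  simp only [map_sub, map_mul, map_pow, map_one, map_ofNat]
  linear_combination (-(C w ^ 2 * (X ^ 4 - 3 * X ^ 2 + 1) ^ 2)) * hsq
end

section
/- For all complex numbers w and F, if F is an eigenvalue of the 10×10 matrix H_10(w), then (F⁴ − 3F² + 1)²·w² = 1 − F^10 + 9F^8 − 28F^6 + 35F^4 − 15F². In particular, whenever F⁴ − 3F² + 1 ≠ 0 the coupling can be expressed as the elementary function w = ±√(1 − F^10 + 9F^8 − 28F^6 + 35F^4 − 15F²)/((F² − 1)² − F²) of the energy F. -/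
open Matrix Polynomial

theorem H10_mulVec (w : ℂ) (v : Fin 10 → ℂ) :
    (H10 w).mulVec v =
      ![-v 1, -v 0 - v 2, -v 1 - v 3, -v 2 - v 4, -v 3 - Complex.I * w * v 4 - v 5,
        -v 4 + Complex.I * w * v 5 - v 6, -v 5 - v 7, -v 6 - v 8, -v 7 - v 9, -v 8] := by
  ext k
  fin_cases k <;> simp [H10, Matrix.mulVec, dotProduct, Fin.sum_univ_succ] <;> ring

/-- If `F` is an eigenvalue of `H_10(w)`, then
`(F⁴ − 3F² + 1)²·w² = 1 − F^10 + 9F^8 − 28F^6 + 35F^4 − 15F²`. -/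
theorem stmt13 (w F : ℂ)
    (hF : ∃ v : Fin 10 → ℂ, v ≠ 0 ∧ (H10 w).mulVec v = F • v) :
    (F^4 - 3*F^2 + 1)^2 * w^2 =
      1 - F^10 + 9*F^8 - 28*F^6 + 35*F^4 - 15*F^2 := by
  obtain ⟨v, hv, h⟩ := hF
  rw [H10_mulVec] at h
  have r0 : -v 1 = F * v 0 := congrFun h 0
  have r1 : -v 0 - v 2 = F * v 1 := congrFun h 1
  have r2 : -v 1 - v 3 = F * v 2 := congrFun h 2
  have r3 : -v 2 - v 4 = F * v 3 := congrFun h 3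
  have r4 : -v 3 - Complex.I * w * v 4 - v 5 = F * v 4 := congrFun h 4
  have r5 : -v 4 + Complex.I * w * v 5 - v 6 = F * v 5 := congrFun h 5
  have r6 : -v 5 - v 7 = F * v 6 := congrFun h 6
  have r7 : -v 6 - v 8 = F * v 7 := congrFun h 7
  have r8 : -v 7 - v 9 = F * v 8 := congrFun h 8
  have r9 : -v 8 = F * v 9 := congrFun h 9
  have v1 : v 1 = -F * v 0 := by linear_combination -r0
  have v2 : v 2 = -F * v 1 - v 0 := by linear_combination -r1
  have v3 : v 3 = -F * v 2 - v 1 := by linear_combination -r2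
  have v4 : v 4 = -F * v 3 - v 2 := by linear_combination -r3
  have v5 : v 5 = -(F + Complex.I * w) * v 4 - v 3 := by linear_combination -r4
  have v6 : v 6 = -(F - Complex.I * w) * v 5 - v 4 := by linear_combination -r5
  have v7 : v 7 = -F * v 6 - v 5 := by linear_combination -r6
  have v8 : v 8 = -F * v 7 - v 6 := by linear_combination -r7
  have v9 : v 9 = -F * v 8 - v 7 := by linear_combination -r8
  have hv0 : v 0 ≠ 0 := by
    intro h0
    apply hv
    ext k
    fin_cases k <;> simp [*]
  have hend : F * v 9 + v 8 = 0 := by linear_combination -r9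
  rw [v9, v8, v7, v6, v5, v4, v3, v2, v1] at hend
  apply mul_right_cancel₀ hv0
  linear_combination (F ^ 4 - 3 * F ^ 2 + 1) ^ 2 * w ^ 2 * v 0 * Complex.I_sq - hend
end
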